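/- arXiv:0908.1152 — 4 statements merged into one kernel-verified Lean document; each statement's English description precedes it below -/
import Mathlib

section
/- If α and β are both legal sequences of topplings for the configuration η (with respect to the same instruction array I) and m_α = m_β, then Φ_α η = Φ_β η. In other words, the result of a legal sequence of topplings depends on the sequence only through its odometer m_α. -/
/-! Diaconis–Fulton representation for Activated Random Walks.

`NatRho` is ℕ ∪ {ρ}, ordered by 0 < ρ < 1 < 2 < ⋯, where `rho` represents one
passive particle. -/

inductive NatRho where
  | nat : ℕ → NatRho
  | rho : NatRho
  deriving DecidableEq

namespace NatRho

/-- Embedding of `NatRho` into ℚ realizing the order 0 < ρ < 1 < 2 < ⋯. -/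
def toVal : NatRho → ℚ
  | nat n => (n : ℚ)
  | rho => 1/2

instance : LE NatRho := ⟨fun a b => a.toVal ≤ b.toVal⟩
instance : LT NatRho := ⟨fun a b => a.toVal < b.toVal⟩

/-- Adding one particle: ρ + 1 = 2. -/
def succ : NatRho → NatRho
  | nat n => nat (n + 1)
  | rho => nat 2

/-- Removing one particle (only ever used when the value is ≥ 1). -/
def pred : NatRho → NatRho
  | nat (n + 1) => nat n
  | a => a

end NatRho

/-- An instruction: `move x y` is τ_{xy}, `sleep x` is τ_{xρ}, `neutral` is ι. -/
inductive Instr (S : Type) where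
  | move : S → S → Instr S
  | sleep : S → Instr S
  | neutral : Instr S
  deriving DecidableEq

/-- `ins.isAt x` : `ins` is an instruction at the site `x`. -/
def Instr.isAt {S : Type} (x : S) : Instr S → Prop
  | .move a b => a = x ∧ b ≠ x
  | .sleep a => a = x
  | .neutral => True

/-- An instruction array `I = (τ^{x,j})`. -/
abbrev InstrArray (S : Type) := S → ℕ → Instr S

/-- Well-formed instruction array: `I x j` is an instruction at `x`. -/
def InstrArray.WF {S : Type} (I : InstrArray S) : Prop := ∀ x j, (I x j).isAt x

variable {S : Type} [DecidableEq S]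

/-- Action of a single instruction on a configuration. -/
def applyInstr (ins : Instr S) (η : S → NatRho) : S → NatRho :=
  match ins with
  | .move x y => fun z => if z = x then (η x).pred else if z = y then (η y).succ else η z
  | .sleep x => fun z => if z = x ∧ η x = .nat 1 then .rho else η z
  | .neutral => η

/-- One toppling step at `x` from the state (configuration, odometer). -/
def step (I : InstrArray S) (st : (S → NatRho) × (S → ℕ)) (x : S) :
    (S → NatRho) × (S → ℕ) :=
  (applyInstr (I x (st.2 x + 1)) st.1, Function.update st.2 x (st.2 x + 1))

/-- Running a sequence of topplings from a given state. -/
def runFrom (I : InstrArray S) (st : (S → NatRho) × (S → ℕ)) (α : List S) :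
    (S → NatRho) × (S → ℕ) :=
  α.foldl (step I) st

/-- A site `x` is unstable in `η` if `η x ≥ 1`. -/
def Unstable (η : S → NatRho) (x : S) : Prop := NatRho.nat 1 ≤ η x

/-- A site `x` is stable in `η` if `η x ∈ {0, ρ}`. -/
def Stable (η : S → NatRho) (x : S) : Prop := ¬ Unstable η x

/-- `α` is a legal sequence of topplings from the state `st`: each toppled site is
unstable at the moment of its toppling. -/
def LegalFrom (I : InstrArray S) : ((S → NatRho) × (S → ℕ)) → List S → Prop
  | _, [] => True
  | st, x :: rest => Unstable st.1 x ∧ LegalFrom I (step I st x) rest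

/-- `α` is a legal sequence of topplings for the configuration `η` (odometer starting
from 0). -/
def Legal (I : InstrArray S) (η : S → NatRho) (α : List S) : Prop :=
  LegalFrom I (η, fun _ => 0) α

/-- `Φ_α η`: the result of the sequence of topplings `α` on `η`. -/
def topple (I : InstrArray S) (η : S → NatRho) (α : List S) : S → NatRho :=
  (runFrom I (η, fun _ => 0) α).1

theorem unstable_iff {T : Type} {η : T → NatRho} {x : T} :
    Unstable η x ↔ ∃ n, η x = .nat (n + 1) := by
  change (NatRho.nat 1).toVal ≤ (η x).toVal ↔ _
  cases η x with
  | nat n =>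
    cases n with
    | zero => norm_num [NatRho.toVal]
    | succ n => simp [NatRho.toVal]
  | rho => simp [NatRho.toVal]; norm_num

/-- An instruction at `y` keeps every other unstable site unstable. -/
theorem Unstable.applyInstr_of_ne {ins : Instr S} {η : S → NatRho} {x y : S}
    (hins : ins.isAt y) (hxy : x ≠ y) (hx : Unstable η x) :
    Unstable (applyInstr ins η) x := by
  obtain ⟨n, hn⟩ := unstable_iff.1 hx
  rw [unstable_iff]
  cases ins with
  | move a b =>
    obtain ⟨rfl, -⟩ := hins
    by_cases hb : x = b
    · subst hb
      exact ⟨n + 1, by simp [applyInstr, hxy, hn, NatRho.succ]⟩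
    · exact ⟨n, by simp [applyInstr, hxy, hb, hn]⟩
  | sleep a =>
    obtain rfl := hins
    exact ⟨n, by simp [applyInstr, hxy, hn]⟩
  | neutral => exact ⟨n, hn⟩

/-- Instructions at two distinct unstable sites commute. -/
theorem applyInstr_comm {i j : Instr S} {η : S → NatRho} {x y : S}
    (hi : i.isAt x) (hj : j.isAt y) (hxy : x ≠ y)
    (hx : Unstable η x) (hy : Unstable η y) :
    applyInstr j (applyInstr i η) = applyInstr i (applyInstr j η) := by
  obtain ⟨m, hm⟩ := unstable_iff.1 hx
  obtain ⟨n, hn⟩ := unstable_iff.1 hy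
  cases i <;> cases j <;> simp only [Instr.isAt] at hi hj <;> funext z <;>
    grind [applyInstr, NatRho.succ, NatRho.pred]

theorem step_comm {I : InstrArray S} (hI : I.WF) {st : (S → NatRho) × (S → ℕ)} {x y : S}
    (hxy : x ≠ y) (hx : Unstable st.1 x) (hy : Unstable st.1 y) :
    step I (step I st x) y = step I (step I st y) x := by
  refine Prod.ext ?_ ?_
  · simpa [step, Function.update_of_ne hxy, Function.update_of_ne hxy.symm] using
      applyInstr_comm (hI x _) (hI y _) hxy hx hy
  · simp only [step, Function.update_of_ne hxy, Function.update_of_ne hxy.symm]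
    exact Function.update_comm hxy _ _ _

/-- In a legal sequence, the first toppling of an initially unstable site can be performed
first, without affecting legality or the result. -/
theorem LegalFrom.move_to_front {I : InstrArray S} (hI : I.WF) {x : S} (γ : List S) :
    ∀ (β : List S) (st : (S → NatRho) × (S → ℕ)), x ∉ β → Unstable st.1 x →
      LegalFrom I st (β ++ x :: γ) →
      LegalFrom I (step I st x) (β ++ γ) ∧
        runFrom I st (β ++ x :: γ) = runFrom I (step I st x) (β ++ γ)
  | [], _, _, _, h => ⟨h.2, rfl⟩
  | y :: β, st, hβ, hx, ⟨hy, h⟩ => by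
    obtain ⟨hxy, hxβ⟩ := List.ne_and_not_mem_of_not_mem_cons hβ
    obtain ⟨hl, hr⟩ := LegalFrom.move_to_front hI γ β (step I st y) hxβ
      (hx.applyInstr_of_ne (hI y _) hxy) h
    rw [← step_comm hI hxy hx hy] at hl hr
    exact ⟨⟨hy.applyInstr_of_ne (hI x _) hxy.symm, hl⟩, hr⟩

theorem LegalFrom.runFrom_eq_of_perm {I : InstrArray S} (hI : I.WF) :
    ∀ (α β : List S) (st : (S → NatRho) × (S → ℕ)), LegalFrom I st α → LegalFrom I st β →
      α.Perm β → runFrom I st α = runFrom I st β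
  | [], _, _, _, _, h => by rw [h.nil_eq]
  | x :: α, β, st, ⟨hx, hα⟩, hβ, h => by
    obtain ⟨β₁, β₂, rfl, hx₁⟩ := List.eq_append_cons_of_mem (h.subset List.mem_cons_self)
    obtain ⟨hl, hr⟩ := LegalFrom.move_to_front hI β₂ β₁ st hx₁ hx hβ
    rw [hr]
    exact LegalFrom.runFrom_eq_of_perm hI α (β₁ ++ β₂) (step I st x) hα hl
      (h.trans List.perm_middle).cons_inv

/-- the result of a legal sequence of topplings depends on the sequence
only through its odometer `m_α = fun x => α.count x`. -/
theorem arw_result_depends_only_on_odometer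
    {d : ℕ} (hd : 1 ≤ d) (I : InstrArray (Fin d → ℤ)) (hI : I.WF)
    (η : (Fin d → ℤ) → NatRho) (α β : List (Fin d → ℤ))
    (hα : Legal I η α) (hβ : Legal I η β)
    (hm : ∀ x, α.count x = β.count x) :
    topple I η α = topple I η β := by
  exact congrArg Prod.fst
    (LegalFrom.runFrom_eq_of_perm hI α β _ hα hβ (List.perm_iff_count.2 hm))
end

section
/- Let α and β be legal sequences of topplings for the configuration η and let x ∈ ℤ^d. If m_β(x) ≥ m_α(x) and m_β(z) ≤ m_α(z) for every z ≠ x, then Φ_β η(x) ≤ Φ_α η(x). That is, Φ_α η(x) is non-increasing in m_α(x) and non-decreasing in m_α(z) for z ≠ x. -/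
variable {S : Type} [DecidableEq S]

namespace NatRho

theorem le_iff {a b : NatRho} : a ≤ b ↔ a.toVal ≤ b.toVal := Iff.rfl

theorem le_refl' (a : NatRho) : a ≤ a := by simp [le_iff]

theorem le_trans' {a b c : NatRho} (h₁ : a ≤ b) (h₂ : b ≤ c) : a ≤ c :=
  le_trans (α := ℚ) h₁ h₂

theorem le_succ (a : NatRho) : a ≤ a.succ := by
  cases a <;> simp [le_iff, succ, toVal]
  norm_num

theorem exists_of_one_le {a : NatRho} (h : nat 1 ≤ a) : ∃ n, a = nat (n + 1) := by
  rcases a with (_ | n) | _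
  · norm_num [le_iff, toVal] at h
  · exact ⟨n, rfl⟩
  · norm_num [le_iff, toVal] at h

end NatRho

/-- Action of an instruction at a site on the content of that site. -/
def Instr.act : Instr S → NatRho → NatRho
  | .move _ _, v => v.pred
  | .sleep _, v => if v = .nat 1 then .rho else v
  | .neutral, v => v

theorem Instr.act_succ {S : Type} (ins : Instr S) {v : NatRho} (h : NatRho.nat 1 ≤ v) :
    ins.act v.succ = (ins.act v).succ := by
  obtain ⟨n, rfl⟩ := NatRho.exists_of_one_le h
  rcases ins with _ | _ | _
  · rfl
  · rcases n with _ | n <;> simp [Instr.act, NatRho.succ]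
  · rfl

theorem Instr.act_le {S : Type} (ins : Instr S) {v : NatRho} (h : NatRho.nat 1 ≤ v) :
    ins.act v ≤ v := by
  obtain ⟨n, rfl⟩ := NatRho.exists_of_one_le h
  rcases ins with _ | _ | _
  · exact NatRho.le_succ (.nat n)
  · rcases n with _ | n
    · norm_num [Instr.act, NatRho.le_iff, NatRho.toVal]
    · simp [Instr.act, NatRho.le_iff]
  · exact NatRho.le_refl' _

/-- Content of a site starting at `v`, after `k` arrivals followed by the first `j`
instructions of the stack `s`. -/
def siteContent (s : ℕ → Instr S) (v : NatRho) (k : ℕ) : ℕ → NatRho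
  | 0 => NatRho.succ^[k] v
  | j + 1 => (s (j + 1)).act (siteContent s v k j)

theorem siteContent_succ_arrivals {S : Type} (s : ℕ → Instr S) (v : NatRho) (k j : ℕ)
    (h : ∀ i < j, NatRho.nat 1 ≤ siteContent s v k i) :
    siteContent s v (k + 1) j = (siteContent s v k j).succ := by
  induction j with
  | zero => simp [siteContent, Function.iterate_succ_apply']
  | succ j ih =>
    rw [siteContent, ih fun i hi => h i (by omega), Instr.act_succ _ (h j (by omega)),
      siteContent]

theorem one_le_siteContent_succ_arrivals {S : Type} (s : ℕ → Instr S) (v : NatRho) (k j : ℕ)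
    (h : ∀ i < j, NatRho.nat 1 ≤ siteContent s v k i) :
    ∀ i < j, NatRho.nat 1 ≤ siteContent s v (k + 1) i := by
  intro i hi
  rw [siteContent_succ_arrivals s v k i fun l hl => h l (by omega)]
  exact NatRho.le_trans' (h i hi) (NatRho.le_succ _)

theorem siteContent_mono_arrivals {S : Type} (s : ℕ → Instr S) (v : NatRho) {k k' j : ℕ} (hk : k ≤ k')
    (h : ∀ i < j, NatRho.nat 1 ≤ siteContent s v k i) :
    siteContent s v k j ≤ siteContent s v k' j := by
  induction k', hk using Nat.le_induction generalizing h with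
  | base => exact NatRho.le_refl' _
  | succ m hm ih =>
    have hm' : ∀ i < j, NatRho.nat 1 ≤ siteContent s v m i := by
      clear ih
      induction m, hm using Nat.le_induction with
      | base => exact h
      | succ m _ ih => exact one_le_siteContent_succ_arrivals s v m j ih
    rw [siteContent_succ_arrivals s v m j hm']
    exact NatRho.le_trans' (ih h) (NatRho.le_succ _)

theorem siteContent_anti_instructions {S : Type} (s : ℕ → Instr S) (v : NatRho) {k j j' : ℕ} (hj : j ≤ j')
    (h : ∀ i < j', NatRho.nat 1 ≤ siteContent s v k i) :
    siteContent s v k j' ≤ siteContent s v k j := by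
  induction j', hj using Nat.le_induction with
  | base => exact NatRho.le_refl' _
  | succ m hm ih =>
    exact NatRho.le_trans' (Instr.act_le _ (h m (by omega))) (ih fun i hi => h i (by omega))

/-- Number of particles sent to `x` from the other sites of `T` when the odometer is `h`. -/
def arrivals (I : InstrArray S) (T : Finset S) (x : S) (h : S → ℕ) : ℕ :=
  ∑ z ∈ T.erase x, ((Finset.range (h z)).filter fun i => I z (i + 1) = .move z x).card

theorem arrivals_mono (I : InstrArray S) (T : Finset S) (x : S) {h h' : S → ℕ}
    (hh : ∀ z, z ≠ x → h z ≤ h' z) : arrivals I T x h ≤ arrivals I T x h' := by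
  refine Finset.sum_le_sum fun z hz => Finset.card_le_card ?_
  exact Finset.filter_subset_filter _
    (Finset.range_subset_range.2 (hh z (Finset.ne_of_mem_erase hz)))

theorem arrivals_update_self (I : InstrArray S) (T : Finset S) (x : S) (h : S → ℕ) (n : ℕ) :
    arrivals I T x (Function.update h x n) = arrivals I T x h := by
  refine Finset.sum_congr rfl fun z hz => ?_
  rw [Function.update_of_ne (Finset.ne_of_mem_erase hz)]

theorem arrivals_update_succ (I : InstrArray S) {T : Finset S} {x z : S} (hzT : z ∈ T)
    (hzx : z ≠ x) (h : S → ℕ) :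
    arrivals I T x (Function.update h z (h z + 1)) =
      arrivals I T x h + if I z (h z + 1) = .move z x then 1 else 0 := by
  have hz : z ∈ T.erase x := Finset.mem_erase.2 ⟨hzx, hzT⟩
  unfold arrivals
  rw [← Finset.add_sum_erase _ _ hz, ← Finset.add_sum_erase _ _ hz, Function.update_self,
    Finset.range_add_one, Finset.filter_insert]
  have : ∀ w ∈ (T.erase x).erase z, Function.update h z (h z + 1) w = h w := fun w hw =>
    Function.update_of_ne (Finset.ne_of_mem_erase hw) _ _
  rw [Finset.sum_congr rfl fun w hw => by rw [this w hw]]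
  split_ifs
  · rw [Finset.card_insert_of_notMem (by simp)]
    omega
  · omega

theorem step_fst_self {I : InstrArray S} (hI : I.WF) (st : (S → NatRho) × (S → ℕ)) (x : S) :
    (step I st x).1 x = (I x (st.2 x + 1)).act (st.1 x) := by
  have h := hI x (st.2 x + 1)
  unfold step
  generalize I x (st.2 x + 1) = ins at h
  rcases ins with ⟨a, b⟩ | a | _
  · obtain ⟨rfl, -⟩ := h
    simp [applyInstr, Instr.act]
  · obtain rfl : a = x := h
    simp [applyInstr, Instr.act]
  · rfl

theorem step_fst_of_ne {I : InstrArray S} (hI : I.WF) (st : (S → NatRho) × (S → ℕ)) {x z : S}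
    (hzx : z ≠ x) :
    (step I st z).1 x =
      if I z (st.2 z + 1) = .move z x then (st.1 x).succ else st.1 x := by
  have h := hI z (st.2 z + 1)
  unfold step
  generalize I z (st.2 z + 1) = ins at h
  rcases ins with ⟨a, b⟩ | a | _
  · obtain ⟨rfl, -⟩ := h
    by_cases hb : b = x
    · subst hb
      simp [applyInstr, hzx.symm]
    · simp [applyInstr, hzx.symm, hb, Ne.symm hb]
  · obtain rfl : a = z := h
    simp [applyInstr, hzx.symm]
  · simp [applyInstr]

/-- The content of `x` in the state `st` is obtained from `η x` by performing first all the
arrivals at `x` and then all the topplings at `x`, each of these topplings being legal. -/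
def Rearranged (I : InstrArray S) (η : S → NatRho) (T : Finset S) (x : S)
    (st : (S → NatRho) × (S → ℕ)) : Prop :=
  st.1 x = siteContent (I x) (η x) (arrivals I T x st.2) (st.2 x) ∧
    ∀ i < st.2 x, NatRho.nat 1 ≤ siteContent (I x) (η x) (arrivals I T x st.2) i

theorem Rearranged.step {I : InstrArray S} (hI : I.WF) {η : S → NatRho} {T : Finset S} {x z : S}
    {st : (S → NatRho) × (S → ℕ)} (h : Rearranged I η T x st) (hz : z ∈ T)
    (hu : Unstable st.1 z) : Rearranged I η T x (step I st z) := by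
  obtain ⟨h₁, h₂⟩ := h
  by_cases hzx : z = x
  · subst hzx
    have hodo : (_root_.step I st z).2 = Function.update st.2 z (st.2 z + 1) := rfl
    refine ⟨?_, ?_⟩
    · rw [step_fst_self hI, hodo, arrivals_update_self, Function.update_self, siteContent, h₁]
    · rw [hodo, arrivals_update_self, Function.update_self]
      intro i hi
      rcases Nat.lt_succ_iff_lt_or_eq.1 hi with hi | rfl
      · exact h₂ i hi
      · rw [← h₁]
        exact hu
  · have hodo : (_root_.step I st z).2 = Function.update st.2 z (st.2 z + 1) := rfl
    unfold Rearranged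
    rw [step_fst_of_ne hI st hzx, hodo, arrivals_update_succ I hz hzx,
      Function.update_of_ne (Ne.symm hzx)]
    split_ifs
    · exact ⟨by rw [siteContent_succ_arrivals _ _ _ _ h₂, h₁],
        one_le_siteContent_succ_arrivals _ _ _ _ h₂⟩
    · exact ⟨h₁, h₂⟩

theorem Rearranged.runFrom {I : InstrArray S} (hI : I.WF) {η : S → NatRho} {T : Finset S} {x : S}
    {α : List S} {st : (S → NatRho) × (S → ℕ)} (h : Rearranged I η T x st)
    (hT : ∀ z ∈ α, z ∈ T) (hα : LegalFrom I st α) : Rearranged I η T x (runFrom I st α) := by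
  induction α generalizing st with
  | nil => exact h
  | cons z α ih =>
    exact ih (h.step hI (hT z (by simp)) hα.1) (fun w hw => hT w (by simp [hw])) hα.2

theorem runFrom_snd (I : InstrArray S) (st : (S → NatRho) × (S → ℕ)) (α : List S) (z : S) :
    (runFrom I st α).2 z = st.2 z + α.count z := by
  induction α generalizing st with
  | nil => rfl
  | cons w α ih =>
    refine (ih (step I st w)).trans ?_
    by_cases hw : w = z
    · subst hw
      simp [step]
      omega
    · simp [step, hw, Ne.symm hw]

theorem Legal.rearranged {I : InstrArray S} (hI : I.WF) {η : S → NatRho} {T : Finset S}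
    {α : List S} (hα : Legal I η α) (hT : ∀ z ∈ α, z ∈ T) (x : S) :
    Rearranged I η T x (runFrom I (η, fun _ => 0) α) :=
  Rearranged.runFrom hI ⟨by simp [arrivals, siteContent], by simp⟩ hT hα

/-- `Φ_α η (x)` is non-increasing in `m_α(x)` and non-decreasing in
`m_α(z)` for `z ≠ x`, over legal sequences `α`. -/
theorem arw_odometer_monotonicity
    {d : ℕ} (hd : 1 ≤ d) (I : InstrArray (Fin d → ℤ)) (hI : I.WF)
    (η : (Fin d → ℤ) → NatRho) (α β : List (Fin d → ℤ))
    (hα : Legal I η α) (hβ : Legal I η β) (x : Fin d → ℤ)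
    (hx : α.count x ≤ β.count x)
    (hz : ∀ z, z ≠ x → β.count z ≤ α.count z) :
    topple I η β x ≤ topple I η α x := by
  have hαr := hα.rearranged hI (T := (α ++ β).toFinset) (fun z hz => by simp [hz]) x
  have hβr := hβ.rearranged hI (T := (α ++ β).toFinset) (fun z hz => by simp [hz]) x
  have hx' : (runFrom I (η, fun _ => 0) α).2 x ≤ (runFrom I (η, fun _ => 0) β).2 x := by
    simpa [runFrom_snd] using hx
  have hk := arrivals_mono I (α ++ β).toFinset x
    (h := (runFrom I (η, fun _ => 0) β).2) (h' := (runFrom I (η, fun _ => 0) α).2)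
    (fun z hzx => by simpa [runFrom_snd] using hz z hzx)
  unfold topple
  rw [hαr.1, hβr.1]
  exact NatRho.le_trans' (siteContent_anti_instructions _ _ hx' hβr.2)
    (siteContent_mono_arrivals _ _ hk fun i hi => hβr.2 i (lt_of_lt_of_le hi hx'))
end

section
/- (Least Action Principle with half topplings) Let V ⊆ ℤ^d be finite. Let β be a sequence of half topplings contained in V that is legal for the configuration η, and let α be a sequence of half topplings (entries anywhere in ℤ^d) that is semi-legal for η and stabilizes η in V. Then m̃_β(x) ≤ m̃_α(x) for every x ∈ ℤ^d. -/
/-! Diaconis–Fulton representation, with half topplings, for the Stochastic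
Sandpile Model. Configurations are `ℕ`-valued; a site is unstable when it carries
at least 2 grains. The instruction array `I x j : S` records the target of the
`j`-th instruction `τ_{x, I x j}` at `x`. -/

/-- Instruction array for the sandpile: `I x j` is the target of the `j`-th
instruction at `x`. -/
abbrev SandArray (S : Type) := S → ℕ → S

/-- Well-formedness: each instruction `τ_{xy}` has `y ≠ x`. -/
def SandArray.WF {S : Type} (I : SandArray S) : Prop := ∀ x j, I x j ≠ x

variable {S : Type} [DecidableEq S]

/-- Action of the instruction `τ_{y t}`: one grain moves from `y` to `t`. -/
def sandApply (y t : S) (η : S → ℕ) : S → ℕ :=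
  fun z => if z = y then η y - 1 else if z = t then η t + 1 else η z

/-- One half toppling at `y` from a state (configuration, half-step counter). -/
def hstep (I : SandArray S) (st : (S → ℕ) × (S → ℕ)) (y : S) : (S → ℕ) × (S → ℕ) :=
  (sandApply y (I y (st.2 y + 1)) st.1, Function.update st.2 y (st.2 y + 1))

/-- Running a sequence of half topplings from a given state. -/
def hrun (I : SandArray S) (st : (S → ℕ) × (S → ℕ)) (β : List S) : (S → ℕ) × (S → ℕ) :=
  β.foldl (hstep I) st

/-- `β` is a semi-legal sequence of half topplings from the state `st`: each half
toppled site holds at least one grain at the moment of its half toppling. -/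
def SemiLegalFrom (I : SandArray S) : ((S → ℕ) × (S → ℕ)) → List S → Prop
  | _, [] => True
  | st, y :: rest => 1 ≤ st.1 y ∧ SemiLegalFrom I (hstep I st y) rest

/-- `β` is a legal sequence of half topplings from the state `st`: each step is
semi-legal and, moreover, performed at a site which is unstable (`≥ 2` grains) or
semi-unstable (an odd number of half topplings so far). -/
def HalfLegalFrom (I : SandArray S) : ((S → ℕ) × (S → ℕ)) → List S → Prop
  | _, [] => True
  | st, y :: rest =>
      (1 ≤ st.1 y) ∧ (2 ≤ st.1 y ∨ Odd (st.2 y)) ∧ HalfLegalFrom I (hstep I st y) rest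

/-- The half-toppling odometer `m̃_β(x)`, i.e. half the number of occurrences of `x`
in `β`, as a rational number. -/
def halfOdo (β : List S) (x : S) : ℚ := (β.count x : ℚ) / 2

/-- A state is stable in `V` if every `x ∈ V` holds at most one grain, and holds no
grain at all if it has been half toppled an odd number of times. -/
def HalfStabilizes (st : (S → ℕ) × (S → ℕ)) (V : Finset S) : Prop :=
  ∀ x ∈ V, st.1 x ≤ 1 ∧ (Odd (st.2 x) → st.1 x = 0)

/-- The doubled sequence `α²`, repeating each entry twice. -/
def doubleSeq : List S → List S
  | [] => []
  | x :: r => x :: x :: doubleSeq r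

/-- `α` is a legal sequence of full topplings from the state `st`: each toppled site
is unstable (`≥ 2` grains) at the moment of its (full) toppling. -/
def FullLegalFrom (I : SandArray S) : ((S → ℕ) × (S → ℕ)) → List S → Prop
  | _, [] => True
  | st, x :: rest => 2 ≤ st.1 x ∧ FullLegalFrom I (hstep I (hstep I st x) x) rest

/-- `Φ_α η`: the result of the sequence of full topplings `α` on `η`, i.e.
`φ_{α²} η`. -/
def fullTopple (I : SandArray S) (η : S → ℕ) (α : List S) : S → ℕ :=
  (hrun I (η, fun _ => 0) (doubleSeq α)).1

/-- `α` is a legal sequence of full topplings for the configuration `η`. -/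
def FullLegal (I : SandArray S) (η : S → ℕ) (α : List S) : Prop :=
  FullLegalFrom I (η, fun _ => 0) α

/-- The number of the first `k` instructions at `y` that target `x`. -/
def SandArray.inflow (I : SandArray S) (y : S) (k : ℕ) (x : S) : ℕ :=
  ((Finset.range k).filter fun j => I y (j + 1) = x).card

theorem SandArray.inflow_succ (I : SandArray S) (y : S) (k : ℕ) (x : S) :
    I.inflow y (k + 1) x = I.inflow y k x + if I y (k + 1) = x then 1 else 0 := by
  unfold SandArray.inflow
  rw [Finset.range_add_one, Finset.filter_insert]
  split_ifs with h <;> simp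

theorem SandArray.inflow_mono (I : SandArray S) (y x : S) {k l : ℕ} (h : k ≤ l) :
    I.inflow y k x ≤ I.inflow y l x :=
  Finset.card_le_card (Finset.filter_subset_filter _ (Finset.range_mono h))

/-- Mass balance of the state `st` reached from the configuration `η` by half topplings
in `T`: at every site, the grains present plus those sent away are the initial grains plus
those received. -/
def MassBalance (I : SandArray S) (T : Finset S) (η : S → ℕ) (st : (S → ℕ) × (S → ℕ)) : Prop :=
  ∀ x, st.1 x + st.2 x = η x + ∑ y ∈ T, I.inflow y (st.2 y) x

theorem massBalance_init (I : SandArray S) (T : Finset S) (η : S → ℕ) :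
    MassBalance I T η (η, fun _ => 0) := by
  intro x
  simp [SandArray.inflow]

theorem MassBalance.hstep {I : SandArray S} (hI : I.WF) {T : Finset S} {η : S → ℕ}
    {st : (S → ℕ) × (S → ℕ)} (h : MassBalance I T η st) {y : S} (hy : y ∈ T)
    (hpos : 1 ≤ st.1 y) : MassBalance I T η (hstep I st y) := by
  intro x
  have hx := h x
  have hsum : ∑ z ∈ T, I.inflow z ((_root_.hstep I st y).2 z) x =
      ∑ z ∈ T, I.inflow z (st.2 z) x + if I y (st.2 y + 1) = x then 1 else 0 := by
    rw [← Finset.add_sum_erase T _ hy, ← Finset.add_sum_erase T (fun z => I.inflow z (st.2 z) x) hy]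
    have hrest : ∑ z ∈ T.erase y, I.inflow z ((_root_.hstep I st y).2 z) x =
        ∑ z ∈ T.erase y, I.inflow z (st.2 z) x :=
      Finset.sum_congr rfl fun z hz => by
        simp [_root_.hstep, Function.update_of_ne (Finset.ne_of_mem_erase hz)]
    rw [hrest]
    simp only [_root_.hstep, Function.update_self, SandArray.inflow_succ]
    omega
  rw [hsum]
  have hne := hI y (st.2 y + 1)
  by_cases hxy : x = y
  · subst hxy
    simp only [_root_.hstep, sandApply, Function.update_self, if_true, if_neg hne]
    omega
  · by_cases hxt : I y (st.2 y + 1) = x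
    · simp [_root_.hstep, sandApply, hxt, hxy]
      omega
    · simp [_root_.hstep, sandApply, hxt, hxy, Ne.symm hxt, hx]

theorem MassBalance.hrun {I : SandArray S} (hI : I.WF) {T : Finset S} {η : S → ℕ}
    (l : List S) {st : (S → ℕ) × (S → ℕ)} (h : MassBalance I T η st)
    (hT : ∀ y ∈ l, y ∈ T) (hl : SemiLegalFrom I st l) : MassBalance I T η (hrun I st l) := by
  induction l generalizing st with
  | nil => exact h
  | cons y l ih =>
    exact ih (h.hstep hI (hT y (by simp)) hl.1) (fun z hz => hT z (by simp [hz])) hl.2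

theorem hrun_snd (I : SandArray S) (st : (S → ℕ) × (S → ℕ)) (l : List S) (x : S) :
    (hrun I st l).2 x = st.2 x + l.count x := by
  induction l generalizing st with
  | nil => simp [hrun]
  | cons y l ih =>
    have := ih (hstep I st y)
    simp only [hrun, List.foldl_cons] at this ⊢
    rw [this]
    by_cases hxy : x = y
    · subst hxy
      simp [hstep]
      omega
    · simp [hstep, hxy, List.count_cons_of_ne (Ne.symm hxy)]

/-- A site half toppled equally often in two balanced states holds at least as many grains in
the one whose counters dominate. -/
theorem MassBalance.le_of_counter_le {I : SandArray S} {T : Finset S} {η : S → ℕ}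
    {st fin : (S → ℕ) × (S → ℕ)} (hst : MassBalance I T η st) (hfin : MassBalance I T η fin)
    (hle : ∀ x, st.2 x ≤ fin.2 x) {y : S} (hy : st.2 y = fin.2 y) : st.1 y ≤ fin.1 y := by
  have hsum : ∑ z ∈ T, I.inflow z (st.2 z) y ≤ ∑ z ∈ T, I.inflow z (fin.2 z) y :=
    Finset.sum_le_sum fun z _ => I.inflow_mono z y (hle z)
  have := hst y
  have := hfin y
  omega

/-- Legal half topplings in `V` never overtake the counters of a balanced state that is
stable in `V`. -/
theorem HalfLegalFrom.counter_le {I : SandArray S} (hI : I.WF) {T V : Finset S} {η : S → ℕ}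
    {fin : (S → ℕ) × (S → ℕ)} (hfin : MassBalance I T η fin) (hstab : HalfStabilizes fin V)
    (β : List S) {st : (S → ℕ) × (S → ℕ)} (hst : MassBalance I T η st)
    (hβ : HalfLegalFrom I st β) (hβT : ∀ y ∈ β, y ∈ T) (hβV : ∀ y ∈ β, y ∈ V)
    (hle : ∀ x, st.2 x ≤ fin.2 x) (x : S) : (hrun I st β).2 x ≤ fin.2 x := by
  induction β generalizing st with
  | nil => exact hle x
  | cons y β ih =>
    obtain ⟨hpos, hleg, hrest⟩ := hβ
    refine ih (hst.hstep hI (hβT y (by simp)) hpos) hrest (fun z hz => hβT z (by simp [hz]))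
      (fun z hz => hβV z (by simp [hz])) fun z => ?_
    by_cases hzy : z = y
    · subst hzy
      simp only [hstep, Function.update_self]
      refine Nat.succ_le_of_lt ((hle z).lt_of_ne fun heq => ?_)
      have hgrains := hst.le_of_counter_le hfin hle heq
      obtain ⟨hone, hodd⟩ := hstab z (hβV z (by simp))
      rcases hleg with htwo | ho
      · omega
      · have := hodd (heq ▸ ho)
        omega
    · simpa [hstep, hzy] using hle z


/-- Least Action Principle with half topplings: if `β` is a legal
sequence of half topplings contained in `V` and `α` is a semi-legal sequence of half
topplings that stabilizes `η` in `V`, then `m̃_β ≤ m̃_α`. -/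
theorem ssm_least_action_principle_half
    {d : ℕ} (hd : 1 ≤ d) (I : SandArray (Fin d → ℤ)) (hI : I.WF)
    (η : (Fin d → ℤ) → ℕ) (V : Finset (Fin d → ℤ)) (α β : List (Fin d → ℤ))
    (hβ : HalfLegalFrom I (η, fun _ => 0) β) (hβV : ∀ y ∈ β, y ∈ V)
    (hα : SemiLegalFrom I (η, fun _ => 0) α)
    (hstab : HalfStabilizes (hrun I (η, fun _ => 0) α) V) :
    ∀ x, halfOdo β x ≤ halfOdo α x := by
  intro x
  have hbal := massBalance_init I (α.toFinset ∪ β.toFinset) η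
  have hle := hβ.counter_le hI (hbal.hrun hI α (by simp +contextual) hα) hstab β hbal
    (by simp +contextual) hβV (by simp) x
  simp only [hrun_snd, zero_add] at hle
  unfold halfOdo
  gcongr
end

section
/- Let d ≥ 1 and let W ⊆ ℤ^d be a set that generates ℤ^d as a group. Then there exist w ∈ ℤ^d and a nonempty open set U ⊆ ℝ^d that is closed under multiplication by positive real scalars (an open cone), such that every point of (w + U) ∩ ℤ^d belongs to the sub-semigroup of (ℤ^d, +) generated by W, i.e. is a sum of finitely many (at least one) elements of W, with repetitions allowed. -/
/-- Every element of the group generated by a set can be translated into the monoid generated by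
that set by an element of the monoid. -/
theorem AddSubgroup.exists_add_mem_addSubmonoidClosure {G : Type*} [AddCommGroup G] {W : Set G}
    {x : G} (hx : x ∈ AddSubgroup.closure W) :
    ∃ m ∈ AddSubmonoid.closure W, x + m ∈ AddSubmonoid.closure W := by
  induction hx using AddSubgroup.closure_induction with
  | mem x hx => exact ⟨0, zero_mem _, by simpa using AddSubmonoid.subset_closure hx⟩
  | zero => exact ⟨0, zero_mem _, by simp⟩
  | add x y _ _ hx hy =>
    obtain ⟨m, hm, hxm⟩ := hx
    obtain ⟨n, hn, hyn⟩ := hy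
    exact ⟨m + n, add_mem hm hn, by rw [add_add_add_comm]; exact add_mem hxm hyn⟩
  | neg x _ hx =>
    obtain ⟨m, hm, hxm⟩ := hx
    exact ⟨x + m, hxm, by simpa using hm⟩

/-- Finitely many elements of the group generated by a set can be translated simultaneously into
the monoid generated by that set. -/
theorem AddSubgroup.exists_forall_add_mem_addSubmonoidClosure {G : Type*} [AddCommGroup G]
    {W F : Set G} (hF : F.Finite) (hFW : F ⊆ AddSubgroup.closure W) :
    ∃ m ∈ AddSubmonoid.closure W, ∀ x ∈ F, x + m ∈ AddSubmonoid.closure W := by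
  induction F, hF using Set.Finite.induction_on with
  | empty => exact ⟨0, zero_mem _, by simp⟩
  | @insert a s _ _ ih =>
    obtain ⟨has, hs⟩ := Set.insert_subset_iff.1 hFW
    obtain ⟨m, hm, hsm⟩ := ih hs
    obtain ⟨n, hn, han⟩ := exists_add_mem_addSubmonoidClosure has
    refine ⟨n + m, add_mem hn hm, ?_⟩
    rintro x (rfl | hx)
    · rw [← add_assoc]
      exact add_mem han hm
    · rw [add_left_comm]
      exact add_mem hn (hsm x hx)

/-- The semigroup generated by a set absorbs the monoid generated by that set. -/
theorem AddSubsemigroup.add_mem_closure_of_mem_addSubmonoidClosure {M : Type*} [AddMonoid M]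
    {W : Set M} {x y : M} (hx : x ∈ AddSubmonoid.closure W) (hy : y ∈ AddSubsemigroup.closure W) :
    x + y ∈ AddSubsemigroup.closure W := by
  induction hx using AddSubmonoid.closure_induction generalizing y with
  | mem x hx => exact add_mem (AddSubsemigroup.subset_closure hx) hy
  | zero => simpa using hy
  | add x x' _ _ hx hx' =>
    rw [add_assoc]
    exact hx (hx' hy)

/-- The coordinatewise inclusion `ℤ^ι → ℝ^ι`. -/
def intVecCast (ι : Type*) : (ι → ℤ) →+ (ι → ℝ) :=
  (Int.castAddHom ℝ).compLeft ι

@[simp]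
theorem intVecCast_apply {ι : Type*} (x : ι → ℤ) (i : ι) : intVecCast ι x i = x i := rfl

theorem span_image_intVecCast_eq_top {ι : Type*} [Finite ι] {W : Set (ι → ℤ)}
    (hW : AddSubgroup.closure W = ⊤) : Submodule.span ℝ (intVecCast ι '' W) = ⊤ := by
  classical
  have key (x : ι → ℤ) : intVecCast ι x ∈ Submodule.span ℝ (intVecCast ι '' W) := by
    have hle : AddSubgroup.closure W ≤
        (Submodule.span ℝ (intVecCast ι '' W)).toAddSubgroup.comap (intVecCast ι) :=
      (AddSubgroup.closure_le _).2 fun w hw => Submodule.subset_span ⟨w, hw, rfl⟩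
    exact hle (hW ▸ AddSubgroup.mem_top x)
  rw [eq_top_iff, ← (Pi.basisFun ℝ ι).span_eq, Submodule.span_le]
  rintro _ ⟨i, rfl⟩
  have h : Pi.basisFun ℝ ι i = intVecCast ι (Pi.single i 1) := ?_
  · exact h ▸ key (Pi.single i 1)
  ext j
  by_cases h : j = i
  · subst h; simp
  · simp [h]

theorem finite_preimage_intVecCast {ι : Type*} [Fintype ι] {B : Set (ι → ℝ)}
    (hB : Bornology.IsBounded B) : (intVecCast ι ⁻¹' B).Finite := by
  classical
  obtain ⟨r, hr⟩ := hB.exists_norm_le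
  refine (Set.finite_Icc (fun _ : ι => -⌈r⌉) (fun _ => ⌈r⌉)).subset fun x hx => ?_
  have h (i : ι) : |x i| ≤ ⌈r⌉ := by
    have h' : |(x i : ℝ)| ≤ (⌈r⌉ : ℝ) :=
      ((norm_le_pi_norm (intVecCast ι x) i).trans (hr _ hx)).trans (Int.le_ceil r)
    exact_mod_cast h'
  exact ⟨fun i => (abs_le.1 (h i)).1, fun i => (abs_le.1 (h i)).2⟩

/-- if `W ⊆ ℤ^d` generates `ℤ^d` as a group, then the sub-semigroup of
`(ℤ^d, +)` generated by `W` contains all lattice points of a translated open cone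
`w + U`, where `U ⊆ ℝ^d` is a nonempty open set closed under multiplication by
positive scalars. -/
theorem semigroup_closure_contains_translated_cone
    (d : ℕ) (hd : 1 ≤ d) (W : Set (Fin d → ℤ))
    (hW : AddSubgroup.closure W = ⊤) :
    ∃ (w : Fin d → ℤ) (U : Set (Fin d → ℝ)),
      IsOpen U ∧ U.Nonempty ∧
      (∀ c : ℝ, 0 < c → ∀ u ∈ U, c • u ∈ U) ∧
      ∀ z : Fin d → ℤ,
        (fun i => (z i : ℝ) - (w i : ℝ)) ∈ U → z ∈ AddSubsemigroup.closure W := by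
  obtain ⟨v₀, hv₀⟩ : W.Nonempty := by
    have : Nonempty (Fin d) := ⟨⟨0, hd⟩⟩
    rw [Set.nonempty_iff_ne_empty]
    rintro rfl
    rw [AddSubgroup.closure_empty] at hW
    exact bot_ne_top hW
  have hspan := (span_image_intVecCast_eq_top hW).ge
  let b := Module.Basis.ofSpan hspan
  have := Module.Finite.finite_basis b
  have := Fintype.ofFinite ((linearIndepOn_empty ℝ id).extend
    (Set.empty_subset (intVecCast (Fin d) '' W)))
  have hb (i) : ∃ v ∈ W, intVecCast (Fin d) v = b i :=
    Module.Basis.ofSpan_subset hspan ⟨i, rfl⟩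
  choose v hvW hv using hb
  obtain ⟨m, -, hm⟩ := AddSubgroup.exists_forall_add_mem_addSubmonoidClosure (W := W)
    (finite_preimage_intVecCast (ZSpan.fundamentalDomain_isBounded b)) (by simp [hW])
  refine ⟨m + v₀, {x | ∀ i, 0 < b.repr x i}, ?_, ⟨∑ i, b i, ?_⟩, ?_, fun z hz => ?_⟩
  · simp only [Set.ofPred_forall]
    exact isOpen_iInter_of_finite fun i =>
      isOpen_lt continuous_const (b.coord i).continuous_of_finiteDimensional
  · intro i
    simp [Finsupp.single_apply]
  · intro c hc u hu i
    simpa using mul_pos hc (hu i)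
  · have hz' (i) : 0 < b.repr (intVecCast (Fin d) (z - (m + v₀))) i := by
      have h : intVecCast (Fin d) (z - (m + v₀)) = fun j => (z j : ℝ) - ((m + v₀) j : ℤ) := by
        ext j
        simp
      exact h ▸ hz i
    let t := fun i => ⌊b.repr (intVecCast (Fin d) (z - (m + v₀))) i⌋₊
    let x := z - (m + v₀) - ∑ i, t i • v i
    have hx : intVecCast (Fin d) x ∈ ZSpan.fundamentalDomain b := by
      rw [ZSpan.mem_fundamentalDomain]
      intro i
      have : b.repr (intVecCast (Fin d) x) i =
          b.repr (intVecCast (Fin d) (z - (m + v₀))) i - t i := by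
        simp only [x, map_sub, map_sum, map_nsmul, hv]
        simp [Finsupp.single_apply]
      rw [this]
      exact ⟨sub_nonneg.2 (Nat.floor_le (hz' i).le), by
        linarith [Nat.lt_floor_add_one (b.repr (intVecCast (Fin d) (z - (m + v₀))) i)]⟩
    have hsum : ∑ i, t i • v i ∈ AddSubmonoid.closure W :=
      sum_mem fun i _ => nsmul_mem (AddSubmonoid.subset_closure (hvW i)) _
    have := AddSubsemigroup.add_mem_closure_of_mem_addSubmonoidClosure
      (add_mem hsum (hm x hx)) (AddSubsemigroup.subset_closure hv₀)
    convert this using 1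
    simp only [x]
    abel
end
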